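/- (Proposition 1, decoding claim) Suppose at least one legal path exists. Then there exists c₀ ∈ ℝ such that for all c ≤ c₀, the set of paths maximizing s(·, l, Ā(A, c)) over all paths equals the set of legal paths maximizing s(·, l, A) over all legal paths; in particular, for c negatively large enough every maximizer of the masked score over all paths is legal. -/

import Mathlib

open Finset Filter Topology

/-- The score of a path `p` given emission logits `l` and transition matrix `A`:
the sum of emission scores plus the sum of transition scores over consecutive pairs. -/
def score {n d : ℕ} (l : Fin (n + 1) → Fin d → ℝ) (A : Fin d → Fin d → ℝ)
    (p : Fin (n + 1) → Fin d) : ℝ :=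
  (∑ i, l i (p i)) + ∑ i : Fin n, A (p i.castSucc) (p i.succ)

/-- The masked transition matrix: entries in the illegal set `Ω` are replaced by `c`. -/
def masked {d : ℕ} (Ω : Finset (Fin d × Fin d)) (A : Fin d → Fin d → ℝ) (c : ℝ) :
    Fin d → Fin d → ℝ :=
  fun i j => if (i, j) ∈ Ω then c else A i j

/-- A path is legal if it contains no illegal transition. -/
def Legal {n d : ℕ} (Ω : Finset (Fin d × Fin d)) (p : Fin (n + 1) → Fin d) : Prop :=
  ∀ i : Fin n, (p i.castSucc, p i.succ) ∉ Ω

instance {n d : ℕ} (Ω : Finset (Fin d × Fin d)) : DecidablePred (Legal (n := n) Ω) :=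
  fun _ => by unfold Legal; infer_instance

/-- Partition function: sum of exponentiated scores over all paths. -/
noncomputable def partAll {n d : ℕ} (l : Fin (n + 1) → Fin d → ℝ)
    (A : Fin d → Fin d → ℝ) : ℝ :=
  ∑ p : Fin (n + 1) → Fin d, Real.exp (score l A p)

/-- Restricted partition function: sum of exponentiated scores over legal paths. -/
noncomputable def partLegal {n d : ℕ} (Ω : Finset (Fin d × Fin d))
    (l : Fin (n + 1) → Fin d → ℝ) (A : Fin d → Fin d → ℝ) : ℝ :=
  ∑ p ∈ Finset.univ.filter (Legal Ω), Real.exp (score l A p)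

/-- The CRF likelihood of a ground-truth path `y`. -/
noncomputable def Lik {n d : ℕ} (y : Fin (n + 1) → Fin d) (l : Fin (n + 1) → Fin d → ℝ)
    (A : Fin d → Fin d → ℝ) : ℝ :=
  Real.exp (score l A y) / partAll l A

/-- The masked-CRF likelihood of a ground-truth path `y`. -/
noncomputable def LikM {n d : ℕ} (Ω : Finset (Fin d × Fin d)) (y : Fin (n + 1) → Fin d)
    (l : Fin (n + 1) → Fin d → ℝ) (A : Fin d → Fin d → ℝ) : ℝ :=
  Real.exp (score l A y) / partLegal Ω l A

/-- The CRF loss over a family of `N` training samples. -/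
noncomputable def crfLoss {n d : ℕ} (N : ℕ) (l : Fin N → Fin (n + 1) → Fin d → ℝ)
    (y : Fin N → Fin (n + 1) → Fin d) (A : Fin d → Fin d → ℝ) : ℝ :=
  -(1 / (N : ℝ)) * ∑ k, Real.log (Lik (y k) (l k) A)

/-- The masked-CRF loss over a family of `N` training samples. -/
noncomputable def mcrfLoss {n d : ℕ} (Ω : Finset (Fin d × Fin d)) (N : ℕ)
    (l : Fin N → Fin (n + 1) → Fin d → ℝ) (y : Fin N → Fin (n + 1) → Fin d)
    (A : Fin d → Fin d → ℝ) : ℝ :=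
  -(1 / (N : ℝ)) * ∑ k, Real.log (LikM Ω (y k) (l k) A)

/-- Masking does not change the score of a legal path. -/
theorem Legal.score_masked {n d : ℕ} {Ω : Finset (Fin d × Fin d)} {p : Fin (n + 1) → Fin d}
    (hp : Legal Ω p) (l : Fin (n + 1) → Fin d → ℝ) (A : Fin d → Fin d → ℝ) (c : ℝ) :
    score l (masked Ω A c) p = score l A p := by
  unfold score masked
  congr 1
  exact Finset.sum_congr rfl fun i _ => if_neg (hp i)

/-- The masked score of an illegal path tends to `-∞` with the masking constant. -/
theorem tendsto_score_masked_atBot {n d : ℕ} {Ω : Finset (Fin d × Fin d)}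
    {p : Fin (n + 1) → Fin d} (hp : ¬ Legal Ω p) (l : Fin (n + 1) → Fin d → ℝ)
    (A : Fin d → Fin d → ℝ) :
    Tendsto (fun c => score l (masked Ω A c) p) atBot atBot := by
  simp only [Legal, not_forall, not_not] at hp
  obtain ⟨j, hj⟩ := hp
  refine tendsto_atBot_mono' atBot ?_ (tendsto_atBot_add_const_left atBot (∑ i, l i (p i))
    (tendsto_atBot_add_const_right atBot
      (∑ i ∈ univ.erase j, |A (p i.castSucc) (p i.succ)|) tendsto_id))
  filter_upwards [eventually_le_atBot (0 : ℝ)] with c hc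
  unfold score
  rw [← Finset.add_sum_erase univ _ (Finset.mem_univ j)]
  gcongr with i
  · simp [masked, hj]
  · unfold masked
    split_ifs
    · exact hc.trans (abs_nonneg _)
    · exact le_abs_self _

/-- Proposition 1, decoding claim: if at least one legal path exists, then
for all negatively large enough `c`, the set of maximizers of the masked score over all
paths equals the set of legal maximizers of the original score over legal paths. -/
theorem stmt_10 {n d : ℕ} (hd : 1 ≤ d) (Ω : Finset (Fin d × Fin d))
    (l : Fin (n + 1) → Fin d → ℝ) (A : Fin d → Fin d → ℝ)
    (hleg : ∃ p : Fin (n + 1) → Fin d, Legal Ω p) :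
    ∃ c₀ : ℝ, ∀ c ≤ c₀,
      {p : Fin (n + 1) → Fin d |
          ∀ q : Fin (n + 1) → Fin d, score l (masked Ω A c) q ≤ score l (masked Ω A c) p} =
      {p : Fin (n + 1) → Fin d |
          Legal Ω p ∧ ∀ q : Fin (n + 1) → Fin d, Legal Ω q → score l A q ≤ score l A p} := by
  obtain ⟨r, hr⟩ := hleg
  have hlt : ∀ᶠ c in atBot, ∀ q : Fin (n + 1) → Fin d, ¬ Legal Ω q →
      score l (masked Ω A c) q < score l A r := by
    refine eventually_all.2 fun q => ?_
    by_cases hq : Legal Ω q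
    · exact .of_forall fun _ h => absurd hq h
    · exact ((tendsto_score_masked_atBot hq l A).eventually_lt_atBot _).mono fun _ h _ => h
  obtain ⟨c₀, hc₀⟩ := eventually_atBot.1 hlt
  refine ⟨c₀, fun c hc => Set.ext fun p => ⟨fun hp => ?_, fun ⟨hp, hmax⟩ q => ?_⟩⟩
  · have hpl : Legal Ω p := by
      by_contra h
      have hrp := hp r
      rw [hr.score_masked] at hrp
      exact (hc₀ c hc p h).not_ge hrp
    refine ⟨hpl, fun q hq => ?_⟩
    have hqp := hp q
    rwa [hq.score_masked, hpl.score_masked] at hqp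
  · rw [hp.score_masked]
    by_cases hq : Legal Ω q
    · rw [hq.score_masked]
      exact hmax q hq
    · exact (hc₀ c hc q hq).le.trans (hmax r hr)
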